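/- Let λ be a Lévy measure on (0,∞) satisfying Condition (E), and suppose λ̄(r) = ℓ(r) for all r ≥ 1, where ℓ is slowly varying. Then η̄₀(r) = o(η̄(r)) as r → ∞, i.e. η̄₀(r)/η̄(r) → 0. -/

import Mathlib

open MeasureTheory Real Filter Set
open scoped ENNReal Topology

noncomputable section

/-- The heat kernel on `ℝ^d` with diffusion constant `κ`. -/
def heatKernel (d : ℕ) (κ : ℝ) (s : ℝ) (x : EuclideanSpace ℝ (Fin d)) : ℝ :=
  (2 * π * κ * s) ^ (-(d : ℝ) / 2) * Real.exp (-‖x‖ ^ 2 / (2 * κ * s))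

/-- A Lévy measure on `(0,∞)`: a nonzero Borel measure carried by `(0,∞)`
with `∫ min(1, z²) λ(dz) < ∞`. -/
def IsLevyMeasure (lam : Measure ℝ) : Prop :=
  lam ≠ 0 ∧ lam (Set.Iic 0) = 0 ∧
    ∫⁻ z in Set.Ioi (0 : ℝ), ENNReal.ofReal (min 1 (z ^ 2)) ∂lam < ⊤

/-- `η̄(r) = (Leb ⊗ Leb ⊗ λ)({(s,y,z) ∈ (0,t] × ℝ^d × (0,∞) : g(s,y) z > r})`. -/
def etaBar (d : ℕ) (κ t : ℝ) (lam : Measure ℝ) (r : ℝ) : ℝ≥0∞ :=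
  (volume.prod (volume.prod lam))
    {p : ℝ × (EuclideanSpace ℝ (Fin d)) × ℝ |
      p.1 ∈ Set.Ioc (0 : ℝ) t ∧ p.2.2 ∈ Set.Ioi (0 : ℝ) ∧
        r < heatKernel d κ p.1 p.2.1 * p.2.2}

/-- `η̄₀(r)`, the analogue of `η̄` with the restriction `|y| ≤ 1/2`. -/
def etaBar0 (d : ℕ) (κ t : ℝ) (lam : Measure ℝ) (r : ℝ) : ℝ≥0∞ :=
  (volume.prod (volume.prod lam))
    {p : ℝ × (EuclideanSpace ℝ (Fin d)) × ℝ |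
      p.1 ∈ Set.Ioc (0 : ℝ) t ∧ p.2.2 ∈ Set.Ioi (0 : ℝ) ∧ ‖p.2.1‖ ≤ 1 / 2 ∧
        r < heatKernel d κ p.1 p.2.1 * p.2.2}

/-- `η̄_A(r)`, where the heat kernel is evaluated at `dist(y, A)`. -/
def etaBarA (d : ℕ) (κ t : ℝ) (lam : Measure ℝ)
    (A : Set (EuclideanSpace ℝ (Fin d))) (r : ℝ) : ℝ≥0∞ :=
  (volume.prod (volume.prod lam))
    {p : ℝ × (EuclideanSpace ℝ (Fin d)) × ℝ |
      p.1 ∈ Set.Ioc (0 : ℝ) t ∧ p.2.2 ∈ Set.Ioi (0 : ℝ) ∧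
        r < (2 * π * κ * p.1) ^ (-(d : ℝ) / 2) *
            Real.exp (-(Metric.infDist p.2.1 A) ^ 2 / (2 * κ * p.1)) * p.2.2}

/-- `τ̄(r) = (Leb ⊗ λ)({(s,z) ∈ (0,t] × (0,∞) : (2πκs)^{-d/2} z > r})`. -/
def tauBar (d : ℕ) (κ t : ℝ) (lam : Measure ℝ) (r : ℝ) : ℝ≥0∞ :=
  (volume.prod lam)
    {p : ℝ × ℝ | p.1 ∈ Set.Ioc (0 : ℝ) t ∧ p.2 ∈ Set.Ioi (0 : ℝ) ∧
      r < (2 * π * κ * p.1) ^ (-(d : ℝ) / 2) * p.2}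

/-- The truncated moment `M_γ(x) = ∫_{(0,x]} z^γ λ(dz)`. -/
def Mgamma (lam : Measure ℝ) (γ x : ℝ) : ℝ≥0∞ :=
  ∫⁻ z in Set.Ioc (0 : ℝ) x, ENNReal.ofReal (z ^ γ) ∂lam

/-- A measurable function, positive on `[1,∞)`, is slowly varying at infinity if
`ℓ(cx)/ℓ(x) → 1` as `x → ∞` for every `c > 0`. -/
def SlowlyVarying (ℓ : ℝ → ℝ) : Prop :=
  Measurable ℓ ∧ (∀ x ≥ (1 : ℝ), 0 < ℓ x) ∧
    ∀ c > (0 : ℝ), Tendsto (fun x => ℓ (c * x) / ℓ x) atTop (𝓝 1)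

/-- Regular variation at infinity with index `-α`: `f` is eventually positive and
`f(cr)/f(r) → c^{-α}` as `r → ∞` for every `c > 0`. -/
def RegVaryNeg (f : ℝ → ℝ) (α : ℝ) : Prop :=
  (∀ᶠ r in atTop, 0 < f r) ∧
    ∀ c > (0 : ℝ), Tendsto (fun r => f (c * r) / f r) atTop (𝓝 (c ^ (-α)))

/-- Condition (E): the necessary and sufficient condition for existence of the solution. -/
def ConditionE (d : ℕ) (lam : Measure ℝ) : Prop :=
  (∫⁻ z in Set.Ioi (1 : ℝ), ENNReal.ofReal (Real.log z ^ ((d : ℝ) / 2)) ∂lam < ⊤) ∧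
  (d = 1 → ∫⁻ z in Set.Ioc (0 : ℝ) 1, ENNReal.ofReal (z ^ 2) ∂lam < ⊤) ∧
  (d = 2 → ∫⁻ z in Set.Ioc (0 : ℝ) 1, ENNReal.ofReal (z ^ 2 * |Real.log z|) ∂lam < ⊤) ∧
  (3 ≤ d → ∫⁻ z in Set.Ioc (0 : ℝ) 1, ENNReal.ofReal (z ^ (1 + 2 / (d : ℝ))) ∂lam < ⊤)

/-- Condition (F): `∫_{(0,1)} z^{2/d} λ(dz) < ∞` if `d ≠ 2`,
and `∫_{(0,1)} z |log z| λ(dz) < ∞` if `d = 2`. -/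
def ConditionF (d : ℕ) (lam : Measure ℝ) : Prop :=
  (d ≠ 2 → ∫⁻ z in Set.Ioo (0 : ℝ) 1, ENNReal.ofReal (z ^ ((2 : ℝ) / d)) ∂lam < ⊤) ∧
  (d = 2 → ∫⁻ z in Set.Ioo (0 : ℝ) 1, ENNReal.ofReal (z * |Real.log z|) ∂lam < ⊤)

theorem IsLevyMeasure.measure_Ioi_lt_top {lam : Measure ℝ} (hlam : IsLevyMeasure lam) {δ : ℝ}
    (hδ : 0 < δ) : lam (Ioi δ) < ⊤ := by
  have hc : 0 < min 1 (δ ^ 2) := by positivity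
  have h : ENNReal.ofReal (min 1 (δ ^ 2)) * lam (Ioi δ) < ⊤ := by
    calc ENNReal.ofReal (min 1 (δ ^ 2)) * lam (Ioi δ)
        = ∫⁻ _ in Ioi δ, ENNReal.ofReal (min 1 (δ ^ 2)) ∂lam := (setLIntegral_const _ _).symm
      _ ≤ ∫⁻ z in Ioi δ, ENNReal.ofReal (min 1 (z ^ 2)) ∂lam := by
          refine setLIntegral_mono (by fun_prop) fun z hz => ?_
          gcongr
          exact hz.le
      _ ≤ ∫⁻ z in Ioi (0 : ℝ), ENNReal.ofReal (min 1 (z ^ 2)) ∂lam :=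
          lintegral_mono_set (Ioi_subset_Ioi hδ.le)
      _ < ⊤ := hlam.2.2
  exact ENNReal.lt_top_of_mul_ne_top_right h.ne (ENNReal.ofReal_pos.2 hc).ne'

theorem IsLevyMeasure.sigmaFinite {lam : Measure ℝ} (hlam : IsLevyMeasure lam) :
    SigmaFinite lam := by
  refine ⟨⟨⟨fun n : ℕ => Iic 0 ∪ Ioi (1 / ((n : ℝ) + 1)), fun _ => trivial, fun n => ?_, ?_⟩⟩⟩
  · refine (measure_union_le _ _).trans_lt ?_
    rw [hlam.2.1, zero_add]
    exact hlam.measure_Ioi_lt_top (by positivity)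
  · refine eq_univ_of_forall fun x => mem_iUnion.2 ?_
    rcases le_or_gt x 0 with hx | hx
    · exact ⟨0, Or.inl hx⟩
    · obtain ⟨n, hn⟩ := exists_nat_one_div_lt hx
      exact ⟨n, Or.inr hn⟩

theorem Mgamma_mono (lam : Measure ℝ) (γ : ℝ) : Monotone (Mgamma lam γ) :=
  fun _ _ h => lintegral_mono_set (Ioc_subset_Ioc_right h)

theorem Mgamma_le_add (lam : Measure ℝ) {γ : ℝ} (hγ : 0 ≤ γ) {a b : ℝ} (ha : 0 ≤ a) :
    Mgamma lam γ b ≤ Mgamma lam γ a + ENNReal.ofReal (b ^ γ) * lam (Ioi a) := by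
  have hsub : Ioc 0 b ⊆ Ioc 0 a ∪ Ioc a b := Ioc_subset_Ioc_union_Ioc
  calc Mgamma lam γ b
      ≤ ∫⁻ z in Ioc 0 a ∪ Ioc a b, ENNReal.ofReal (z ^ γ) ∂lam := lintegral_mono_set hsub
    _ ≤ Mgamma lam γ a + ∫⁻ z in Ioc a b, ENNReal.ofReal (z ^ γ) ∂lam := lintegral_union_le _ _ _
    _ ≤ Mgamma lam γ a + ∫⁻ _ in Ioc a b, ENNReal.ofReal (b ^ γ) ∂lam := by
        refine add_le_add le_rfl (setLIntegral_mono measurable_const fun z hz => ?_)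
        exact ENNReal.ofReal_le_ofReal (rpow_le_rpow (ha.trans hz.1.le) hz.2 hγ)
    _ ≤ Mgamma lam γ a + ENNReal.ofReal (b ^ γ) * lam (Ioi a) := by
        rw [setLIntegral_const]
        gcongr
        exact Ioc_subset_Ioi_self

theorem ConditionE.Mgamma_one_lt_top {d : ℕ} (hd : 1 ≤ d) {lam : Measure ℝ}
    (hlam : IsLevyMeasure lam) (hE : ConditionE d lam) :
    Mgamma lam (1 + 2 / (d : ℝ)) 1 < ⊤ := by
  rcases le_or_gt 3 d with h3 | h3
  · exact hE.2.2.2 h3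
  · have hd0 : (0 : ℝ) < d := by exact_mod_cast hd
    have hd2 : (d : ℝ) ≤ 2 := by exact_mod_cast Nat.lt_succ_iff.1 h3
    have hγ : (2 : ℝ) ≤ 1 + 2 / (d : ℝ) := by
      have : 1 ≤ 2 / (d : ℝ) := (one_le_div hd0).2 hd2
      linarith
    refine lt_of_le_of_lt ?_ hlam.2.2
    calc Mgamma lam (1 + 2 / (d : ℝ)) 1
        ≤ ∫⁻ z in Ioc (0 : ℝ) 1, ENNReal.ofReal (min 1 (z ^ 2)) ∂lam := by
          refine setLIntegral_mono (by fun_prop) fun z hz => ENNReal.ofReal_le_ofReal ?_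
          rw [min_eq_right (pow_le_one₀ hz.1.le hz.2), ← rpow_two]
          exact rpow_le_rpow_of_exponent_ge hz.1 hz.2 hγ
      _ ≤ _ := lintegral_mono_set Ioc_subset_Ioi_self

theorem SlowlyVarying.eventually_le_mul {ℓ : ℝ → ℝ} (hℓ : SlowlyVarying ℓ) {c q : ℝ} (hc : 0 < c)
    (hq : 1 < q) : ∀ᶠ x in atTop, ℓ (c * x) ≤ q * ℓ x := by
  filter_upwards [(hℓ.2.2 c hc).eventually_le_const hq, eventually_ge_atTop 1] with x hx h1
  exact (div_le_iff₀ (hℓ.2.1 x h1)).1 hx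

theorem Mgamma_le_mul_tail {lam : Measure ℝ} (hlam : IsLevyMeasure lam) {γ : ℝ} (hγ : 1 ≤ γ)
    (hM : Mgamma lam γ 1 < ⊤) {ℓ : ℝ → ℝ} (hℓ : SlowlyVarying ℓ)
    (hrep : ∀ r ≥ (1 : ℝ), lam (Ioi r) = ENNReal.ofReal (ℓ r)) :
    ∃ C ≥ (0 : ℝ), ∀ᶠ r in atTop, Mgamma lam γ r ≤ ENNReal.ofReal (C * r ^ γ * ℓ r) := by
  obtain ⟨a, ha⟩ := eventually_atTop.1
    (hℓ.eventually_le_mul (c := 1 / 2) (q := 3 / 2) (by norm_num) (by norm_num))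
  set x₀ := max a 1
  have hx₀ : 1 ≤ x₀ := le_max_right _ _
  have hfin : Mgamma lam γ (2 * x₀) < ⊤ := by
    refine (Mgamma_le_add lam (by linarith) zero_le_one).trans_lt ?_
    exact ENNReal.add_lt_top.2
      ⟨hM, ENNReal.mul_lt_top ENNReal.ofReal_lt_top (hlam.measure_Ioi_lt_top one_pos)⟩
  set B := (Mgamma lam γ (2 * x₀)).toReal
  have hpos : 0 < ℓ (2 * x₀) := hℓ.2.1 _ (by linarith)
  set C := max 6 (B / ℓ (2 * x₀))
  have hC6 : 6 ≤ C := le_max_left _ _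
  have hCB : B ≤ C * ℓ (2 * x₀) := (div_le_iff₀ hpos).1 (le_max_right _ _)
  have key : ∀ n : ℕ, ∀ r, x₀ ≤ r → r ≤ 2 ^ (n + 1) * x₀ →
      Mgamma lam γ r ≤ ENNReal.ofReal (C * r ^ γ * ℓ r) := by
    intro n
    induction n with
    | zero =>
      intro r h1 h2
      have h2' : r ≤ 2 * x₀ := by simpa using h2
      have hanti : ℓ (2 * x₀) ≤ ℓ r := by
        have h : lam (Ioi (2 * x₀)) ≤ lam (Ioi r) := measure_mono (Ioi_subset_Ioi h2')
        rw [hrep _ (by linarith), hrep _ (by linarith)] at h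
        exact (ENNReal.ofReal_le_ofReal_iff (hℓ.2.1 r (by linarith)).le).1 h
      calc Mgamma lam γ r ≤ Mgamma lam γ (2 * x₀) := Mgamma_mono lam γ h2'
        _ = ENNReal.ofReal B := (ENNReal.ofReal_toReal hfin.ne).symm
        _ ≤ _ := by
          refine ENNReal.ofReal_le_ofReal (hCB.trans ?_)
          have h1r : 1 ≤ r ^ γ := one_le_rpow (by linarith) (by linarith)
          calc C * ℓ (2 * x₀) ≤ C * ℓ r := by gcongr
            _ = C * 1 * ℓ r := by ring
            _ ≤ C * r ^ γ * ℓ r := by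
              have := (hℓ.2.1 r (by linarith)).le
              gcongr
    | succ n ih =>
      intro r h1 h2
      rcases le_or_gt r (2 ^ (n + 1) * x₀) with h | h
      · exact ih r h1 h
      have hr2 : x₀ ≤ r / 2 := by
        have : (1 : ℝ) ≤ 2 ^ n := one_le_pow₀ (by norm_num)
        rw [pow_succ] at h
        nlinarith
      have hr2' : r / 2 ≤ 2 ^ (n + 1) * x₀ := by
        rw [pow_succ] at h2
        linarith
      have hℓ0 : 0 < ℓ r := hℓ.2.1 r (by linarith)
      have hr0 : 0 < r ^ γ := rpow_pos_of_pos (by linarith) _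
      have hstep : ℓ (r / 2) ≤ 3 / 2 * ℓ r := by
        have := ha r ((le_max_left _ _).trans h1)
        rwa [one_div, inv_mul_eq_div] at this
      have hhalf : (r / 2) ^ γ ≤ r ^ γ / 2 := by
        rw [div_rpow (by linarith) (by norm_num)]
        gcongr
        calc (2 : ℝ) = 2 ^ (1 : ℝ) := (rpow_one _).symm
          _ ≤ 2 ^ γ := rpow_le_rpow_of_exponent_le (by norm_num) hγ
      have hr20 : 0 < (r / 2) ^ γ := rpow_pos_of_pos (by linarith) _
      have hC0 : 0 < C := by linarith
      have hℓ2 : 0 < ℓ (r / 2) := hℓ.2.1 _ (by linarith)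
      calc Mgamma lam γ r
          ≤ Mgamma lam γ (r / 2) + ENNReal.ofReal (r ^ γ) * lam (Ioi (r / 2)) :=
            Mgamma_le_add lam (by linarith) (by linarith)
        _ ≤ ENNReal.ofReal (C * (r / 2) ^ γ * ℓ (r / 2))
              + ENNReal.ofReal (r ^ γ) * ENNReal.ofReal (ℓ (r / 2)) := by
            rw [hrep _ (by linarith)]
            gcongr
            exact ih _ hr2 hr2'
        _ = ENNReal.ofReal (C * (r / 2) ^ γ * ℓ (r / 2) + r ^ γ * ℓ (r / 2)) := by
            rw [ENNReal.ofReal_add (by positivity) (by positivity), ENNReal.ofReal_mul hr0.le]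
        _ ≤ _ := by
          refine ENNReal.ofReal_le_ofReal ?_
          calc C * (r / 2) ^ γ * ℓ (r / 2) + r ^ γ * ℓ (r / 2)
              ≤ C * (r ^ γ / 2) * (3 / 2 * ℓ r) + r ^ γ * (3 / 2 * ℓ r) := by gcongr
            _ = (C * (3 / 4) + 3 / 2) * (r ^ γ * ℓ r) := by ring
            _ ≤ C * (r ^ γ * ℓ r) := by
              gcongr
              linarith
            _ = _ := by ring
  refine ⟨C, by linarith, ?_⟩
  filter_upwards [eventually_ge_atTop x₀] with r hr
  obtain ⟨n, hn⟩ := pow_unbounded_of_one_lt (r / x₀) (one_lt_two : (1 : ℝ) < 2)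
  refine key n r hr ?_
  rw [div_lt_iff₀ (by linarith)] at hn
  rw [pow_succ]
  nlinarith

theorem measurable_heatKernel (d : ℕ) (κ : ℝ) :
    Measurable fun p : ℝ × EuclideanSpace ℝ (Fin d) => heatKernel d κ p.1 p.2 := by
  unfold heatKernel
  fun_prop

theorem heatKernel_nonneg (d : ℕ) {κ s : ℝ} (hκ : 0 ≤ κ) (hs : 0 ≤ s)
    (y : EuclideanSpace ℝ (Fin d)) : 0 ≤ heatKernel d κ s y := by
  unfold heatKernel
  positivity

theorem integral_heatKernel (d : ℕ) {κ s : ℝ} (hκ : 0 < κ) (hs : 0 < s) :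
    ∫ y : EuclideanSpace ℝ (Fin d), heatKernel d κ s y = 1 := by
  have h := GaussianFourier.integral_rexp_neg_mul_sq_norm (V := EuclideanSpace ℝ (Fin d))
    (b := 1 / (2 * κ * s)) (by positivity)
  have hfun : ∀ y : EuclideanSpace ℝ (Fin d), heatKernel d κ s y =
      (2 * π * κ * s) ^ (-(d : ℝ) / 2) * rexp (-(1 / (2 * κ * s)) * ‖y‖ ^ 2) := by
    intro y
    unfold heatKernel
    congr 2
    ring
  simp_rw [hfun]
  rw [integral_const_mul, h, finrank_euclideanSpace_fin,
    show π / (1 / (2 * κ * s)) = 2 * π * κ * s by field_simp, ← rpow_add (by positivity),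
    show -(d : ℝ) / 2 + d / 2 = 0 by ring, rpow_zero]

theorem volume_lt_heatKernel_le (d : ℕ) {κ s ρ : ℝ} (hκ : 0 < κ) (hs : 0 < s) (hρ : 0 < ρ) :
    volume {y : EuclideanSpace ℝ (Fin d) | ρ < heatKernel d κ s y} ≤ ENNReal.ofReal ρ⁻¹ := by
  have hint := integral_heatKernel d hκ hs
  have hmeas : Measurable fun y : EuclideanSpace ℝ (Fin d) => heatKernel d κ s y :=
    (measurable_heatKernel d κ).comp measurable_prodMk_left
  have hlint : ∫⁻ y : EuclideanSpace ℝ (Fin d), ENNReal.ofReal (heatKernel d κ s y) = 1 := by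
    rw [← ofReal_integral_eq_lintegral_ofReal (integrable_of_integral_eq_one hint)
      (ae_of_all _ fun y => heatKernel_nonneg d hκ.le hs.le y), hint, ENNReal.ofReal_one]
  calc volume {y : EuclideanSpace ℝ (Fin d) | ρ < heatKernel d κ s y}
      ≤ volume {y : EuclideanSpace ℝ (Fin d) |
          ENNReal.ofReal ρ ≤ ENNReal.ofReal (heatKernel d κ s y)} :=
        measure_mono fun y hy => ENNReal.ofReal_le_ofReal (le_of_lt hy)
    _ ≤ (∫⁻ y, ENNReal.ofReal (heatKernel d κ s y)) / ENNReal.ofReal ρ :=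
        meas_ge_le_lintegral_div hmeas.ennreal_ofReal.aemeasurable (by simpa using hρ)
          ENNReal.ofReal_ne_top
    _ = ENNReal.ofReal ρ⁻¹ := by
        rw [hlint, ENNReal.ofReal_inv_of_pos hρ, one_div]

theorem time_le_of_lt_heatKernel_mul {d : ℕ} (hd : 1 ≤ d) {κ s z r : ℝ} (hκ : 0 < κ) (hs : 0 < s)
    (hz : 0 < z) (hr : 0 < r) {y : EuclideanSpace ℝ (Fin d)} (h : r < heatKernel d κ s y * z) :
    s ≤ (2 * π * κ)⁻¹ * (z / r) ^ (2 / (d : ℝ)) := by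
  have hd0 : (0 : ℝ) < d := by exact_mod_cast hd
  have hexp : rexp (-‖y‖ ^ 2 / (2 * κ * s)) ≤ 1 :=
    exp_le_one_iff.2 (div_nonpos_of_nonpos_of_nonneg (by simp) (by positivity))
  set u := 2 * π * κ * s with hu
  have hu0 : 0 < u := by positivity
  have h1 : r < u ^ (-(d : ℝ) / 2) * z := by
    refine h.trans_le ?_
    unfold heatKernel
    have : 0 ≤ u ^ (-(d : ℝ) / 2) := by positivity
    gcongr
    exact mul_le_of_le_one_right this hexp
  have h2 : u ^ ((d : ℝ) / 2) ≤ z / r := by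
    rw [neg_div, rpow_neg hu0.le, inv_mul_eq_div, lt_div_iff₀ (by positivity)] at h1
    rw [le_div_iff₀ hr, mul_comm]
    exact h1.le
  have h3 : u ≤ (z / r) ^ (2 / (d : ℝ)) := by
    calc u = (u ^ ((d : ℝ) / 2)) ^ (2 / (d : ℝ)) := by
          rw [← rpow_mul hu0.le, show (d : ℝ) / 2 * (2 / d) = 1 by field_simp, rpow_one]
      _ ≤ _ := by gcongr
  rw [inv_mul_eq_div, le_div_iff₀ (by positivity)]
  calc s * (2 * π * κ) = u := by rw [hu]; ring
    _ ≤ _ := h3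

theorem measure_small_jumps_le {d : ℕ} (hd : 1 ≤ d) {κ : ℝ} (hκ : 0 < κ) (lam : Measure ℝ)
    [SFinite lam] {r : ℝ} (hr : 0 < r) :
    (volume.prod (volume.prod lam)) {p : ℝ × (EuclideanSpace ℝ (Fin d)) × ℝ |
        0 < p.1 ∧ p.2.2 ∈ Ioc 0 r ∧ r < heatKernel d κ p.1 p.2.1 * p.2.2} ≤
      ENNReal.ofReal ((2 * π * κ)⁻¹ * (r ^ (1 + 2 / (d : ℝ)))⁻¹) *
        Mgamma lam (1 + 2 / (d : ℝ)) r := by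
  set B := {p : ℝ × (EuclideanSpace ℝ (Fin d)) × ℝ |
        0 < p.1 ∧ p.2.2 ∈ Ioc 0 r ∧ r < heatKernel d κ p.1 p.2.1 * p.2.2}
  set S := {q : ℝ × ℝ | q.1 ∈ Ioc 0 ((2 * π * κ)⁻¹ * (q.2 / r) ^ (2 / (d : ℝ))) ∧
    q.2 ∈ Ioc 0 r} with hS
  have hSm : MeasurableSet S := by
    refine MeasurableSet.inter (MeasurableSet.inter ?_ ?_) (measurable_snd measurableSet_Ioc)
    · exact measurableSet_lt measurable_const measurable_fst
    · exact measurableSet_le measurable_fst (by fun_prop)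
  have hBm : MeasurableSet B := by
    have hg : Measurable fun p : ℝ × (EuclideanSpace ℝ (Fin d)) × ℝ =>
        heatKernel d κ p.1 p.2.1 * p.2.2 :=
      ((measurable_heatKernel d κ).comp
        (measurable_fst.prodMk measurable_snd.fst)).mul measurable_snd.snd
    exact (measurableSet_lt measurable_const measurable_fst).inter
      ((measurable_snd.snd measurableSet_Ioc).inter (measurableSet_lt measurable_const hg))
  set f : ℝ → ℝ → ℝ≥0∞ := fun s z => S.indicator (fun q => ENNReal.ofReal (q.2 / r)) (s, z)
    with hf
  have hslice : ∀ s z, volume {y : EuclideanSpace ℝ (Fin d) | (s, y, z) ∈ B} ≤ f s z := by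
    intro s z
    by_cases hq : (s, z) ∈ S
    · rw [hf]
      simp only [indicator_of_mem hq]
      have hs : 0 < s := hq.1.1
      have hz : 0 < z := hq.2.1
      calc volume {y : EuclideanSpace ℝ (Fin d) | (s, y, z) ∈ B}
          ≤ volume {y : EuclideanSpace ℝ (Fin d) | r / z < heatKernel d κ s y} :=
            measure_mono fun y hy => (div_lt_iff₀ hz).2 hy.2.2
        _ ≤ ENNReal.ofReal (r / z)⁻¹ := volume_lt_heatKernel_le d hκ hs (by positivity)
        _ = _ := by rw [inv_div]
    · have : {y : EuclideanSpace ℝ (Fin d) | (s, y, z) ∈ B} = ∅ := by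
        refine eq_empty_of_forall_notMem fun y hy => hq ?_
        exact ⟨⟨hy.1, time_le_of_lt_heatKernel_mul hd hκ hy.1 hy.2.1.1 hr hy.2.2⟩, hy.2.1⟩
      rw [this, measure_empty]
      exact zero_le
  have hfm : Measurable (Function.uncurry f) :=
    Measurable.indicator (by fun_prop) hSm
  calc (volume.prod (volume.prod lam)) B
      = ∫⁻ s, (volume.prod lam) (Prod.mk s ⁻¹' B) := Measure.prod_apply hBm
    _ = ∫⁻ s, ∫⁻ z, volume {y : EuclideanSpace ℝ (Fin d) | (s, y, z) ∈ B} ∂lam := by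
        refine lintegral_congr fun s => ?_
        rw [Measure.prod_apply_symm (measurable_prodMk_left hBm)]
        rfl
    _ ≤ ∫⁻ s, ∫⁻ z, f s z ∂lam := lintegral_mono fun s => lintegral_mono fun z => hslice s z
    _ = ∫⁻ z, (∫⁻ s, f s z) ∂lam := lintegral_lintegral_swap hfm.aemeasurable
    _ = ∫⁻ z in Ioc 0 r, ENNReal.ofReal (z / r) *
          ENNReal.ofReal ((2 * π * κ)⁻¹ * (z / r) ^ (2 / (d : ℝ))) ∂lam := by
        rw [← lintegral_indicator measurableSet_Ioc]
        refine lintegral_congr fun z => ?_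
        by_cases hz : z ∈ Ioc 0 r
        · have hfz : ∀ s, f s z = (Ioc 0 ((2 * π * κ)⁻¹ * (z / r) ^ (2 / (d : ℝ)))).indicator
              (fun _ => ENNReal.ofReal (z / r)) s := by
            intro s
            simp only [hf, hS, indicator, mem_ofPred_eq, hz, and_true]
          rw [indicator_of_mem hz]
          simp_rw [hfz]
          rw [lintegral_indicator_const measurableSet_Ioc, Real.volume_Ioc, sub_zero]
        · have hfz : ∀ s, f s z = 0 := fun s => indicator_of_notMem (fun h => hz h.2) _
          simp [hfz, indicator_of_notMem hz]
    _ = ∫⁻ z in Ioc 0 r, ENNReal.ofReal ((2 * π * κ)⁻¹ * (r ^ (1 + 2 / (d : ℝ)))⁻¹) *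
          ENNReal.ofReal (z ^ (1 + 2 / (d : ℝ))) ∂lam := by
        refine setLIntegral_congr_fun measurableSet_Ioc fun z hz => ?_
        have hz0 : 0 < z := hz.1
        rw [← ENNReal.ofReal_mul (by positivity), ← ENNReal.ofReal_mul (by positivity),
          div_rpow hz0.le hr.le, rpow_add hz0, rpow_add hr, rpow_one, rpow_one]
        congr 1
        field_simp
    _ = _ := lintegral_const_mul _ (by fun_prop)

theorem etaBar0_le {d : ℕ} (hd : 1 ≤ d) {κ : ℝ} (hκ : 0 < κ) (t : ℝ) (lam : Measure ℝ)
    [SFinite lam] {r : ℝ} (hr : 0 < r) :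
    etaBar0 d κ t lam r ≤
      ENNReal.ofReal t * (volume (Metric.ball (0 : EuclideanSpace ℝ (Fin d)) 1) * lam (Ioi r)) +
      ENNReal.ofReal ((2 * π * κ)⁻¹ * (r ^ (1 + 2 / (d : ℝ)))⁻¹) *
        Mgamma lam (1 + 2 / (d : ℝ)) r := by
  calc etaBar0 d κ t lam r
      ≤ (volume.prod (volume.prod lam))
          (Ioc 0 t ×ˢ Metric.ball (0 : EuclideanSpace ℝ (Fin d)) 1 ×ˢ Ioi r ∪
            {p : ℝ × (EuclideanSpace ℝ (Fin d)) × ℝ |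
              0 < p.1 ∧ p.2.2 ∈ Ioc 0 r ∧ r < heatKernel d κ p.1 p.2.1 * p.2.2}) := by
        refine measure_mono fun p hp => ?_
        obtain ⟨hs, hz, hy, h⟩ := hp
        rcases lt_or_ge r p.2.2 with hrz | hrz
        · refine Or.inl ⟨hs, ?_, hrz⟩
          rw [mem_ball_zero_iff]
          linarith
        · exact Or.inr ⟨hs.1, ⟨hz, hrz⟩, h⟩
    _ ≤ _ := measure_union_le _ _
    _ ≤ _ := by
        refine add_le_add (le_of_eq ?_) (measure_small_jumps_le hd hκ lam hr)
        rw [Measure.prod_prod, Measure.prod_prod, Real.volume_Ioc, sub_zero]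

theorem exists_le_etaBar {d : ℕ} {κ t : ℝ} (hκ : 0 < κ) (ht : 0 < t) (lam : Measure ℝ)
    [SFinite lam] {K : ℝ} (hK : 0 ≤ K) :
    ∃ M > (0 : ℝ), ∀ r > 0, ENNReal.ofReal (t / 2) * (ENNReal.ofReal (K ^ d) *
      volume (Metric.ball (0 : EuclideanSpace ℝ (Fin d)) 1) * lam (Ioi (M * r))) ≤
        etaBar d κ t lam r := by
  set m := (2 * π * κ * t) ^ (-(d : ℝ) / 2) * rexp (-K ^ 2 / (2 * κ * (t / 2))) with hm
  have hm0 : 0 < m := by positivity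
  refine ⟨m⁻¹, by positivity, fun r hr => ?_⟩
  calc _ = (volume.prod (volume.prod lam)) (Ioc (t / 2) t ×ˢ
          Metric.closedBall (0 : EuclideanSpace ℝ (Fin d)) K ×ˢ Ioi (m⁻¹ * r)) := by
        rw [Measure.prod_prod, Measure.prod_prod, Real.volume_Ioc,
          Measure.addHaar_closedBall _ _ hK, finrank_euclideanSpace_fin, sub_half]
    _ ≤ _ := by
        refine measure_mono ?_
        rintro ⟨s, y, z⟩ ⟨⟨hs1, hs2⟩, hy, hz⟩
        simp only at hs1 hs2 hy hz
        rw [mem_closedBall_zero_iff] at hy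
        rw [mem_Ioi] at hz
        have hs : 0 < s := by linarith
        have hz0 : 0 < z := lt_trans (by positivity) hz
        refine ⟨⟨hs, hs2⟩, hz0, ?_⟩
        have hg : m ≤ heatKernel d κ s y := by
          unfold heatKernel
          rw [hm]
          refine mul_le_mul ?_ ?_ (exp_pos _).le (by positivity)
          · refine rpow_le_rpow_of_nonpos (by positivity) (by gcongr) ?_
            rw [neg_div]
            exact neg_nonpos.2 (by positivity)
          · rw [exp_le_exp, neg_div, neg_div, neg_le_neg_iff]
            gcongr
        rw [inv_mul_lt_iff₀ hm0] at hz
        exact hz.trans_le (mul_le_mul_of_nonneg_right hg hz0.le)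

theorem tendsto_toReal_div_toReal_zero {α : Type*} {l : Filter α} {f g : α → ℝ≥0∞}
    (h : ∀ ε > (0 : ℝ), ∀ᶠ x in l, f x ≤ ENNReal.ofReal ε * g x) :
    Tendsto (fun x => (f x).toReal / (g x).toReal) l (𝓝 0) := by
  refine Metric.tendsto_nhds.2 fun ε hε => ?_
  filter_upwards [h (ε / 2) (by positivity)] with x hx
  rw [dist_zero_right, norm_of_nonneg (by positivity)]
  refine lt_of_le_of_lt ?_ (half_lt_self hε)
  rcases eq_or_ne (g x) ⊤ with hg | hg
  · simp only [hg, ENNReal.toReal_top, div_zero]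
    positivity
  · refine div_le_of_le_mul₀ ENNReal.toReal_nonneg (by positivity) ?_
    have := ENNReal.toReal_mono (ENNReal.mul_ne_top ENNReal.ofReal_ne_top hg) hx
    rwa [ENNReal.toReal_mul, ENNReal.toReal_ofReal (by positivity)] at this

/-- Lemma 4.3 (ii): under Condition (E), if `λ̄(r) = ℓ(r)` for `r ≥ 1` with `ℓ`
slowly varying, then `η̄₀(r) = o(η̄(r))` as `r → ∞`. -/
theorem stmt_18 (d : ℕ) (hd : 1 ≤ d) (κ t : ℝ) (hκ : 0 < κ) (ht : 0 < t)
    (lam : Measure ℝ) (hlam : IsLevyMeasure lam) (hE : ConditionE d lam)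
    (ℓ : ℝ → ℝ) (hℓ : SlowlyVarying ℓ)
    (hrep : ∀ r ≥ (1 : ℝ), (lam (Set.Ioi r)).toReal = ℓ r) :
    Tendsto (fun r : ℝ =>
        (etaBar0 d κ t lam r).toReal / (etaBar d κ t lam r).toReal)
      atTop (𝓝 0) := by
  have := hlam.sigmaFinite
  have hrep' : ∀ r ≥ (1 : ℝ), lam (Ioi r) = ENNReal.ofReal (ℓ r) := fun r hr => by
    rw [← hrep r hr, ENNReal.ofReal_toReal (hlam.measure_Ioi_lt_top (by linarith)).ne]
  obtain ⟨C, hC0, hC⟩ := Mgamma_le_mul_tail hlam (γ := 1 + 2 / (d : ℝ))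
    (by simp only [le_add_iff_nonneg_right]; positivity) (hE.Mgamma_one_lt_top hd hlam) hℓ hrep'
  set V := (volume (Metric.ball (0 : EuclideanSpace ℝ (Fin d)) 1)).toReal
  have hVtop : volume (Metric.ball (0 : EuclideanSpace ℝ (Fin d)) 1) ≠ ⊤ :=
    measure_ball_lt_top.ne
  have hV : volume (Metric.ball (0 : EuclideanSpace ℝ (Fin d)) 1) = ENNReal.ofReal V :=
    (ENNReal.ofReal_toReal hVtop).symm
  have hV0 : 0 < V :=
    ENNReal.toReal_pos (Metric.measure_ball_pos volume _ one_pos).ne' hVtop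
  set D := t * V + (2 * π * κ)⁻¹ * C
  have hD0 : 0 ≤ D := by positivity
  refine tendsto_toReal_div_toReal_zero fun ε hε => ?_
  set K := max 1 (D * 4 / (ε * t * V))
  have hK1 : 1 ≤ K := le_max_left _ _
  have hKd : D ≤ ε * (t / 4 * (K ^ d * V)) := by
    have h1 : D * 4 / (ε * t * V) ≤ K ^ d :=
      (le_max_right _ _).trans (le_self_pow₀ hK1 (by omega))
    rw [div_le_iff₀ (by positivity)] at h1
    linarith
  obtain ⟨M, hM0, hM⟩ := exists_le_etaBar (d := d) hκ ht lam (K := K) (by linarith)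
  have htail : ∀ᶠ r in atTop, ℓ r ≤ 2 * ℓ (M * r) := by
    have h := (tendsto_id.const_mul_atTop hM0).eventually
      (hℓ.eventually_le_mul (inv_pos.2 hM0) one_lt_two)
    filter_upwards [h] with r hr
    rwa [id, inv_mul_cancel_left₀ hM0.ne'] at hr
  filter_upwards [hC, htail, eventually_ge_atTop 1,
    (tendsto_id.const_mul_atTop hM0).eventually_ge_atTop 1] with r hCr htr hr hMr
  have hMr' : 1 ≤ M * r := hMr
  have hℓr := hℓ.2.1 r hr
  have hℓM := hℓ.2.1 _ hMr'
  have hr0 : 0 < r := by linarith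
  have hrγ : 0 < r ^ (1 + 2 / (d : ℝ)) := rpow_pos_of_pos hr0 _
  calc etaBar0 d κ t lam r
      ≤ ENNReal.ofReal t * (ENNReal.ofReal V * ENNReal.ofReal (ℓ r)) +
        ENNReal.ofReal ((2 * π * κ)⁻¹ * (r ^ (1 + 2 / (d : ℝ)))⁻¹) *
          ENNReal.ofReal (C * r ^ (1 + 2 / (d : ℝ)) * ℓ r) := by
        rw [← hV, ← hrep' r hr]
        exact (etaBar0_le hd hκ t lam hr0).trans (by gcongr)
    _ = ENNReal.ofReal (D * ℓ r) := by
        rw [← ENNReal.ofReal_mul hV0.le, ← ENNReal.ofReal_mul ht.le,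
          ← ENNReal.ofReal_mul (by positivity), ← ENNReal.ofReal_add (by positivity)
            (by positivity)]
        congr 1
        simp only [D]
        field_simp
    _ ≤ ENNReal.ofReal (ε * (t / 2 * (K ^ d * V * ℓ (M * r)))) := by
        refine ENNReal.ofReal_le_ofReal ?_
        calc D * ℓ r ≤ D * (2 * ℓ (M * r)) := by gcongr
          _ ≤ ε * (t / 4 * (K ^ d * V)) * (2 * ℓ (M * r)) := by gcongr
          _ = _ := by ring
    _ = ENNReal.ofReal ε * (ENNReal.ofReal (t / 2) * (ENNReal.ofReal (K ^ d) *
          volume (Metric.ball (0 : EuclideanSpace ℝ (Fin d)) 1) * lam (Ioi (M * r)))) := by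
        have hK0 : 0 < K := by linarith
        rw [hV, hrep' _ hMr', ENNReal.ofReal_mul hε.le, ENNReal.ofReal_mul (by positivity),
          ENNReal.ofReal_mul (by positivity), ENNReal.ofReal_mul (by positivity)]
    _ ≤ _ := by
        gcongr
        exact hM r hr0
end
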